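/- For every finite connected simple graph G, the rainbow connection number of G is at most 2·f(G) + 2, where f(G) is the forest number of G. -/

import Mathlib

open SimpleGraph

/-- A coloring `c` of the (potential) edges of `G` makes `G` rainbow-connected if every pair of
vertices is joined by a path whose edges all receive pairwise distinct colors. -/
def IsRainbowConnected {V : Type*} {n : ℕ} (G : SimpleGraph V) (c : Sym2 V → Fin n) : Prop :=
  ∀ u v : V, ∃ p : G.Walk u v, p.IsPath ∧ (p.edges.map c).Nodup

/- The forest number of `G`: the maximum number of vertices inducing an acyclic subgraph. -/
open Classical in
noncomputable def forestNum {V : Type*} [Fintype V] (G : SimpleGraph V) : ℕ :=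
  Nat.findGreatest
    (fun n => ∃ S : Finset V, S.card = n ∧ (G.induce (S : Set V)).IsAcyclic)
    (Fintype.card V)

namespace SimpleGraph

variable {V : Type*} {G : SimpleGraph V}

/-- Adding a vertex with at most one neighbor in `S` to a set `S` that induces a forest yields
a set that induces a forest. -/
lemma IsAcyclic.induce_insert {S : Set V} {v : V} (hS : (G.induce S).IsAcyclic)
    (hv : ∀ a ∈ S, ∀ b ∈ S, G.Adj v a → G.Adj v b → a = b) :
    (G.induce (insert v S)).IsAcyclic := by
  classical
  intro a c hc
  have hinj : Function.Injective (Embedding.induce (G := G) (insert v S)).toHom :=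
    (Embedding.induce (G := G) (insert v S)).injective
  by_cases hvc : (⟨v, Set.mem_insert _ _⟩ : ↥(insert v S)) ∈ c.support
  · have hd := hc.rotate hvc
    set d := c.rotate _ hvc
    have h1 := d.adj_snd hd.not_nil
    have h2 := (d.adj_penultimate hd.not_nil).symm
    have mem : ∀ x : ↥(insert v S), (G.induce (insert v S)).Adj ⟨v, Set.mem_insert _ _⟩ x →
        (x : V) ∈ S := by
      rintro ⟨x, hx⟩ hadj
      have hadj' : G.Adj v x := hadj
      exact hx.resolve_left hadj'.ne'
    exact hd.snd_ne_penultimate (Subtype.ext (hv _ (mem _ h1) _ (mem _ h2) h1 h2))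
  · have hsup : ∀ x ∈ (c.map (Embedding.induce (G := G) (insert v S)).toHom).support, x ∈ S := by
      intro x hx
      rw [Walk.support_map, List.mem_map] at hx
      obtain ⟨⟨y, hy⟩, hyc, rfl⟩ := hx
      refine hy.resolve_left ?_
      rintro rfl
      exact hvc hyc
    refine hS ((c.map (Embedding.induce (G := G) (insert v S)).toHom).induce S hsup) ?_
    rw [← Walk.isCycle_map_iff_of_injective
      (f := (Embedding.induce (G := G) S).toHom) (Embedding.induce (G := G) S).injective,
      Walk.map_induce]
    exact (Walk.isCycle_map_iff_of_injective hinj).2 hc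

/-- Every vertex of `D` is joined to `r` by a walk of `G` that stays inside `D` and uses only
edges of `E`. -/
def IsSpannedFrom (G : SimpleGraph V) (r : V) (D : Finset V) (E : Finset (Sym2 V)) : Prop :=
  ∀ u ∈ D, ∃ p : G.Walk r u, (∀ x ∈ p.support, x ∈ D) ∧ ∀ e ∈ p.edges, e ∈ E

lemma IsSpannedFrom.insert [DecidableEq V] {r v w : V} {D : Finset V} {E : Finset (Sym2 V)}
    (h : G.IsSpannedFrom r D E) (hw : w ∈ D) (hwv : G.Adj w v) :
    G.IsSpannedFrom r (insert v D) (insert s(w, v) E) := by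
  intro u hu
  rcases Finset.mem_insert.1 hu with rfl | hu
  · obtain ⟨p, hpD, hpE⟩ := h w hw
    refine ⟨p.concat hwv, fun x hx => ?_, fun e he => ?_⟩
    · simp only [Walk.support_concat, List.mem_append,
        List.mem_singleton] at hx
      rcases hx with hx | rfl
      · exact Finset.mem_insert_of_mem (hpD x hx)
      · exact Finset.mem_insert_self _ _
    · simp only [Walk.edges_concat, List.concat_eq_append, List.mem_append,
        List.mem_singleton] at he
      rcases he with he | rfl
      · exact Finset.mem_insert_of_mem (hpE e he)
      · exact Finset.mem_insert_self _ _
  · obtain ⟨p, hpD, hpE⟩ := h u hu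
    exact ⟨p, fun x hx => Finset.mem_insert_of_mem (hpD x hx),
      fun e he => Finset.mem_insert_of_mem (hpE e he)⟩

lemma IsSpannedFrom.exists_isPath {r : V} {D : Finset V} {E : Finset (Sym2 V)}
    (h : G.IsSpannedFrom r D E) {u v : V} (hu : u ∈ D) (hv : v ∈ D) :
    ∃ p : G.Walk u v, p.IsPath ∧ (∀ x ∈ p.support, x ∈ D) ∧ ∀ e ∈ p.edges, e ∈ E := by
  classical
  obtain ⟨p, hpD, hpE⟩ := h u hu
  obtain ⟨q, hqD, hqE⟩ := h v hv
  refine ⟨(p.reverse.append q).bypass, Walk.bypass_isPath _, fun x hx => ?_, fun e he => ?_⟩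
  · have hx := Walk.support_bypass_subset_support _ hx
    rw [Walk.mem_support_append_iff, Walk.support_reverse, List.mem_reverse] at hx
    exact hx.elim (hpD x) (hqD x)
  · have he := Walk.edges_bypass_subset_edges _ he
    rw [Walk.edges_append, Walk.edges_reverse, List.mem_append, List.mem_reverse] at he
    exact he.elim (hpE e) (hqE e)

/-- A finite connected graph has a set `D` of vertices, spanned by a set `E` of edges, such that
every vertex outside `D` has two neighbors in `D`, and such that `E` has at most twice as many
elements as some induced forest. -/
lemma Connected.exists_isSpannedFrom_two_neighbors [Finite V] (hG : G.Connected) :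
    ∃ (r : V) (D S : Finset V) (E : Finset (Sym2 V)),
      (G.induce (S : Set V)).IsAcyclic ∧ E.card ≤ 2 * S.card ∧ G.IsSpannedFrom r D E ∧
      ∀ v ∉ D, ∃ x ∈ D, ∃ y ∈ D, x ≠ y ∧ G.Adj v x ∧ G.Adj v y := by
  classical
  obtain ⟨r⟩ := hG.nonempty
  let P : Finset V → Prop := fun D => r ∈ D ∧ ∃ (S : Finset V) (E : Finset (Sym2 V)), S ⊆ D ∧
    (G.induce (S : Set V)).IsAcyclic ∧ E.card ≤ 2 * S.card ∧ G.IsSpannedFrom r D E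
  have hP : P {r} := by
    refine ⟨by simp, ∅, ∅, by simp, ?_, by simp, ?_⟩
    · have : IsEmpty ((∅ : Finset V) : Set V) := by simp
      exact IsAcyclic.of_subsingleton
    · intro u hu
      obtain rfl := Finset.mem_singleton.1 hu
      exact ⟨Walk.nil, by simp, by simp⟩
  obtain ⟨D, hD⟩ := (Set.toFinite {D | P D}).exists_maximal ⟨_, hP⟩
  obtain ⟨hrD, S, E, hSD, hS, hE, hspan⟩ := hD.prop
  have hmax : ∀ v ∉ D, ∀ D', P D' → D ⊆ D' → v ∉ D' := fun v hv D' hD' hle hv' =>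
    hv (hD.le_of_ge hD' hle hv')
  have hdom : ∀ v, v ∈ D ∨ ∃ w ∈ D, G.Adj w v := by
    by_contra! hcon
    obtain ⟨z, hz⟩ := hcon
    obtain ⟨p⟩ := hG.preconnected r z
    obtain ⟨d, -, hd1, hd2⟩ := p.exists_boundary_dart {v | v ∈ D ∨ ∃ w ∈ D, G.Adj w v}
      (Or.inl hrD) (fun h => h.elim hz.1 fun ⟨w, hw, hwz⟩ => hz.2 w hw hwz)
    simp only [Set.mem_ofPred_eq, not_or, not_exists, not_and] at hd1 hd2
    obtain ⟨hvD, hvN⟩ := hd2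
    have hwv := d.adj
    obtain ⟨t, ht, htw⟩ := hd1.resolve_left fun h => hvN _ h hwv
    refine hmax _ hvD (insert d.snd (insert d.fst D)) ⟨by simp [hrD], insert d.snd S, _,
      Finset.insert_subset_insert _ (hSD.trans (Finset.subset_insert _ _)), ?_, ?_,
      (hspan.insert ht htw).insert (Finset.mem_insert_self _ _) hwv⟩
      ((Finset.subset_insert _ _).trans (Finset.subset_insert _ _)) (Finset.mem_insert_self _ _)
    · rw [Finset.coe_insert]
      exact hS.induce_insert fun a ha b _ hva _ => (hvN a (hSD ha) hva.symm).elim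
    · rw [Finset.card_insert_of_notMem fun h => hvD (hSD h)]
      have h1 := Finset.card_insert_le s(t, d.fst) E
      have h2 := Finset.card_insert_le s(d.fst, d.snd) (insert s(t, d.fst) E)
      omega
  refine ⟨r, D, S, E, hS, hE, hspan, fun v hv => ?_⟩
  obtain ⟨w, hw, hwv⟩ := (hdom v).resolve_left hv
  by_contra! hcon
  refine hmax v hv (insert v D) ⟨by simp [hrD], insert v S, _,
    Finset.insert_subset_insert _ hSD, ?_, ?_, hspan.insert hw hwv⟩
    (Finset.subset_insert _ _) (Finset.mem_insert_self _ _)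
  · rw [Finset.coe_insert]
    refine hS.induce_insert fun a ha b hb hva hvb => ?_
    by_contra hab
    exact hcon a (hSD ha) b (hSD hb) hab hva hvb
  · rw [Finset.card_insert_of_notMem fun h => hv (hSD h)]
    have h1 := Finset.card_insert_le s(w, v) E
    omega

/-- If `E` spans `D` and every vertex outside `D` has two neighbors in `D`, then `E.card + 2`
colors suffice to make `G` rainbow-connected. -/
lemma IsSpannedFrom.exists_isRainbowConnected {r : V} {D : Finset V} {E : Finset (Sym2 V)}
    (h : G.IsSpannedFrom r D E)
    (hD : ∀ v ∉ D, ∃ x ∈ D, ∃ y ∈ D, x ≠ y ∧ G.Adj v x ∧ G.Adj v y) {n : ℕ}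
    (hn : E.card ≤ n) : ∃ c : Sym2 V → Fin (n + 2), IsRainbowConnected G c := by
  classical
  choose! x hx y hy hxy hvx hvy using hD
  let A : Fin (n + 2) := ⟨n, by omega⟩
  let B : Fin (n + 2) := ⟨n + 1, by omega⟩
  let c : Sym2 V → Fin (n + 2) := fun e =>
    if ∃ v ∉ D, e = s(v, x v) then A
    else if ∃ v ∉ D, e = s(v, y v) then B
    else if he : e ∈ E then ⟨E.equivFin ⟨e, he⟩, by have := (E.equivFin ⟨e, he⟩).2; omega⟩
    else A
  have hcA : ∀ v ∉ D, c s(v, x v) = A := fun v hv => if_pos ⟨v, hv, rfl⟩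
  have hcB : ∀ v ∉ D, c s(v, y v) = B := by
    intro v hv
    have h1 : ¬ ∃ u ∉ D, s(v, y v) = s(u, x u) := by
      rintro ⟨u, hu, he⟩
      rcases Sym2.eq_iff.1 he with ⟨rfl, h2⟩ | ⟨h2, -⟩
      · exact hxy v hv h2.symm
      · exact hv (h2 ▸ hx u hu)
    exact (if_neg h1).trans (if_pos ⟨v, hv, rfl⟩)
  have hcE : ∀ e (he : e ∈ E), (∀ z ∈ e, z ∈ D) →
      (c e : ℕ) = E.equivFin ⟨e, he⟩ := by
    intro e he hz
    have h1 : ¬ ∃ v ∉ D, e = s(v, x v) := by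
      rintro ⟨v, hv, rfl⟩
      exact hv (hz v (Sym2.mem_mk_left _ _))
    have h2 : ¬ ∃ v ∉ D, e = s(v, y v) := by
      rintro ⟨v, hv, rfl⟩
      exact hv (hz v (Sym2.mem_mk_left _ _))
    simp only [c, if_neg h1, if_neg h2, dif_pos he]
  have hpath : ∀ u ∈ D, ∀ v ∈ D, ∃ p : G.Walk u v, p.IsPath ∧ (∀ z ∈ p.support, z ∈ D) ∧
      (p.edges.map c).Nodup ∧ A ∉ p.edges.map c ∧ B ∉ p.edges.map c := by
    intro u hu v hv
    obtain ⟨p, hp, hpD, hpE⟩ := h.exists_isPath hu hv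
    have hval : ∀ e (he : e ∈ p.edges), (c e : ℕ) = E.equivFin ⟨e, hpE e he⟩ := fun e he =>
      hcE e (hpE e he) fun z hz => hpD z (p.mem_support_of_mem_edges he hz)
    have hlt : ∀ e ∈ p.edges, (c e : ℕ) < n := fun e he => by
      rw [hval e he]
      exact (E.equivFin ⟨e, hpE e he⟩).2.trans_le hn
    refine ⟨p, hp, hpD, ?_, ?_, ?_⟩
    · refine List.Nodup.map_on (fun e he f hf hef => ?_) hp.isTrail.edges_nodup
      have hef := congrArg Fin.val hef
      rw [hval e he, hval f hf] at hef
      exact congrArg Subtype.val (E.equivFin.injective (Fin.ext hef))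
    · intro hA
      obtain ⟨e, he, heA⟩ := List.mem_map.1 hA
      have := hlt e he
      simp [heA, A] at this
    · intro hB
      obtain ⟨e, he, heB⟩ := List.mem_map.1 hB
      have := hlt e he
      simp [heB, B] at this
  have hAB : A ≠ B := by simp [A, B]
  have hout : ∀ u ∉ D, ∀ v ∈ D, ∃ p : G.Walk u v, p.IsPath ∧
      (∀ z ∈ p.support, z = u ∨ z ∈ D) ∧ (p.edges.map c).Nodup ∧ B ∉ p.edges.map c := by
    intro u hu v hv
    obtain ⟨p, hp, hpD, hpn, hpA, hpB⟩ := hpath _ (hx u hu) v hv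
    refine ⟨.cons (hvx u hu) p, hp.cons fun hup => hu (hpD u hup), fun z hz => ?_, ?_, ?_⟩
    · rw [Walk.support_cons, List.mem_cons] at hz
      exact hz.imp_right (hpD z)
    · rw [Walk.edges_cons, List.map_cons, hcA u hu]
      exact List.nodup_cons.2 ⟨hpA, hpn⟩
    · rw [Walk.edges_cons, List.map_cons, hcA u hu, List.mem_cons]
      exact fun h => h.elim hAB.symm hpB
  refine ⟨c, fun u v => ?_⟩
  by_cases hv : v ∈ D
  · by_cases hu : u ∈ D
    · obtain ⟨p, hp, -, hpn, -⟩ := hpath u hu v hv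
      exact ⟨p, hp, hpn⟩
    · obtain ⟨p, hp, -, hpn, -⟩ := hout u hu v hv
      exact ⟨p, hp, hpn⟩
  · obtain rfl | huv := eq_or_ne u v
    · exact ⟨.nil, .nil, by simp⟩
    · obtain ⟨p, hp, hpD, hpn, hpB⟩ : ∃ p : G.Walk u (y v), p.IsPath ∧
          (∀ z ∈ p.support, z = u ∨ z ∈ D) ∧ (p.edges.map c).Nodup ∧ B ∉ p.edges.map c := by
        by_cases hu : u ∈ D
        · obtain ⟨p, hp, hpD, hpn, -, hpB⟩ := hpath u hu _ (hy v hv)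
          exact ⟨p, hp, fun z hz => .inr (hpD z hz), hpn, hpB⟩
        · exact hout u hu _ (hy v hv)
      have hvp : v ∉ p.support := fun hvp => (hpD v hvp).elim huv.symm hv
      refine ⟨p.concat (hvy v hv).symm, hp.concat hvp _, ?_⟩
      rw [Walk.edges_concat, List.concat_eq_append, List.map_append, List.map_singleton,
        Sym2.eq_swap, hcB v hv, List.nodup_append_comm]
      exact List.nodup_cons.2 ⟨hpB, hpn⟩

end SimpleGraph

lemma card_le_forestNum {V : Type*} [Fintype V] {G : SimpleGraph V} {S : Finset V}
    (hS : (G.induce (S : Set V)).IsAcyclic) : S.card ≤ forestNum G := by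
  classical
  exact Nat.le_findGreatest (Finset.card_le_univ S) ⟨S, rfl, hS⟩

/-- For every finite connected simple graph `G`, there is an edge coloring with at most
`2 * forestNum G + 2` colors under which every pair of vertices is joined by a rainbow path,
i.e. `rc(G) ≤ 2f(G) + 2`. -/
theorem rc_le_two_mul_forestNum_add_two {V : Type*} [Fintype V] (G : SimpleGraph V)
    (hG : G.Connected) :
    ∃ c : Sym2 V → Fin (2 * forestNum G + 2), IsRainbowConnected G c := by
  obtain ⟨r, D, S, E, hS, hE, hspan, hD⟩ := hG.exists_isSpannedFrom_two_neighbors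
  exact hspan.exists_isRainbowConnected hD
    (hE.trans (Nat.mul_le_mul_left 2 (card_le_forestNum hS)))
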